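/- Let N be a positive natural number and let v : Fin N → Fin 4 be not identically 0 (so the N-qubit Pauli string P_v is not the identity string). Then there exist an index k : Fin N and a value a ∈ {1, 2, 3} such that, letting w : Fin N → Fin 4 be the function equal to a at k and 0 elsewhere, the weight-one Pauli string P_w anticommutes with P_v: P_w · P_v = −(P_v · P_w). -/

import Mathlib

open Matrix Complex

/-- The single-qubit Pauli matrices: `σ₀ = I`, `σ₁ = X`, `σ₂ = Y`, `σ₃ = Z`. -/
noncomputable def pauli : Fin 4 → Matrix (Fin 2) (Fin 2) ℂ
  | 0 => !![1, 0; 0, 1]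
  | 1 => !![0, 1; 1, 0]
  | 2 => !![0, -Complex.I; Complex.I, 0]
  | 3 => !![1, 0; 0, -1]

/-- The `N`-qubit Pauli string `P_v`: the Kronecker (tensor) product of the single-qubit
matrices `pauli (v k)`, realised as the matrix indexed by `Fin N → Fin 2` whose
`(i, j)` entry is `∏ k, (pauli (v k)) (i k) (j k)`. -/
noncomputable def pauliString {N : ℕ} (v : Fin N → Fin 4) :
    Matrix (Fin N → Fin 2) (Fin N → Fin 2) ℂ :=
  Matrix.of fun i j => ∏ k : Fin N, pauli (v k) (i k) (j k)

/-- Pauli strings multiply factor by factor. -/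
theorem pauliString_mul_apply {N : ℕ} (v w : Fin N → Fin 4) (i j : Fin N → Fin 2) :
    (pauliString v * pauliString w) i j = ∏ k, (pauli (v k) * pauli (w k)) (i k) (j k) := by
  simp only [pauliString, Matrix.mul_apply, Matrix.of_apply, ← Finset.prod_mul_distrib]
  exact (Fintype.prod_sum fun k l => pauli (v k) (i k) l * pauli (w k) l (j k)).symm

theorem pauli_zero : pauli 0 = 1 := Matrix.one_fin_two.symm

/-- Every non-identity Pauli matrix anticommutes with some non-identity Pauli matrix. -/
theorem exists_pauli_anticommuting (b : Fin 4) (hb : b ≠ 0) :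
    ∃ a ∈ ({1, 2, 3} : Set (Fin 4)), pauli a * pauli b = -(pauli b * pauli a) := by
  fin_cases b
  · exact absurd rfl hb
  · exact ⟨3, by simp, by simp [pauli]⟩
  · exact ⟨3, by simp, by simp [pauli]⟩
  · exact ⟨1, by simp, by simp [pauli]⟩

/-- Pauli strings anticommute if exactly one pair of corresponding factors anticommutes and all
others commute. -/
theorem pauliString_anticommute {N : ℕ} {v w : Fin N → Fin 4} (k : Fin N)
    (hk : pauli (w k) * pauli (v k) = -(pauli (v k) * pauli (w k)))
    (hne : ∀ l ≠ k, Commute (pauli (w l)) (pauli (v l))) :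
    pauliString w * pauliString v = -(pauliString v * pauliString w) := by
  ext i j
  rw [Matrix.neg_apply, pauliString_mul_apply, pauliString_mul_apply,
    ← Finset.mul_prod_erase _ _ (Finset.mem_univ k),
    ← Finset.mul_prod_erase _ _ (Finset.mem_univ k), hk, Matrix.neg_apply, neg_mul]
  congr 2
  refine Finset.prod_congr rfl fun l hl => ?_
  rw [(hne l (Finset.ne_of_mem_erase hl)).eq]

/-- For any non-identity Pauli string `P_v` there is a weight-one Pauli string that
anticommutes with it. -/
theorem exists_weight_one_anticommuting {N : ℕ} (hN : 0 < N) (v : Fin N → Fin 4)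
    (hv : v ≠ fun _ => 0) :
    ∃ (k : Fin N) (a : Fin 4), a ∈ ({1, 2, 3} : Set (Fin 4)) ∧
      pauliString (Function.update (fun _ => (0 : Fin 4)) k a) * pauliString v =
        -(pauliString v * pauliString (Function.update (fun _ => (0 : Fin 4)) k a)) := by
  obtain ⟨k, hk⟩ := Function.ne_iff.mp hv
  obtain ⟨a, ha, h⟩ := exists_pauli_anticommuting (v k) hk
  refine ⟨k, a, ha, pauliString_anticommute k ?_ fun l hl => ?_⟩
  · rwa [Function.update_self]
  · rw [Function.update_of_ne hl, pauli_zero]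
    exact Commute.one_left _
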